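/- Lower bound on the closest reachable point on the +x-axis when l − r ≡ 2 (mod 4): Let σ be a turn sequence with l L's and r R's, l − r ≥ 0 and l − r ≡ 2 (mod 4), and let C be any chain realizing σ whose endpoint is (a, 0) with a > 0. If σ₁ = L, then a ≥ |⌊(l − r + 2)/4⌋ − 2| + 2; if σ₁ = R, then a ≥ ⌊(l − r + 2)/4⌋ + 1. -/

import Mathlib

/-- A turn: left (`L`) or right (`R`). -/
inductive Turn : Type
  | L : Turn
  | R : Turn
  deriving DecidableEq

/-- Rotation of a direction vector by 90° counterclockwise. -/
def rotCCW (d : ℤ × ℤ) : ℤ × ℤ := (-d.2, d.1)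

/-- Rotation of a direction vector by 90° clockwise. -/
def rotCW (d : ℤ × ℤ) : ℤ × ℤ := (d.2, -d.1)

/-- Unit direction of the axis-parallel segment from `u` to `v`. -/
def unitDir (u v : ℤ × ℤ) : ℤ × ℤ := ((v.1 - u.1).sign, (v.2 - u.2).sign)

/-- The set of integer points on the axis-parallel closed segment from `u` to `v`. -/
def segSet (u v : ℤ × ℤ) : Set (ℤ × ℤ) :=
  {q | min u.1 v.1 ≤ q.1 ∧ q.1 ≤ max u.1 v.1 ∧ min u.2 v.2 ≤ q.2 ∧ q.2 ≤ max u.2 v.2}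

/-- A simple rectilinear chain realizing the turn sequence `σ = σ₁⋯σₙ` (as a list,
`σ.get ⟨i, _⟩` is the `(i+1)`-st turn `σ_{i+1}`).  It consists of the points
`pts 0, …, pts (n+1)` with `pts 0 = (0,0)`; consecutive points span nondegenerate
axis-parallel segments, the first segment heads east, the chain turns left (CCW) or
right (CW) at each bend as prescribed by `σ`, and the chain is simple. -/
structure Chain (σ : List Turn) where
  pts : ℕ → ℤ × ℤ
  start_eq : pts 0 = (0, 0)
  first_seg : ∃ t : ℤ, 0 < t ∧ pts 1 = (t, 0)
  axis_parallel : ∀ i ≤ σ.length,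
    ((pts (i + 1)).1 = (pts i).1 ∧ (pts (i + 1)).2 ≠ (pts i).2) ∨
    ((pts (i + 1)).2 = (pts i).2 ∧ (pts (i + 1)).1 ≠ (pts i).1)
  turns : ∀ i, ∀ h : i < σ.length,
    unitDir (pts (i + 1)) (pts (i + 2)) =
      (if σ.get ⟨i, h⟩ = Turn.L then rotCCW else rotCW) (unitDir (pts i) (pts (i + 1)))
  simple_adj : ∀ i, i + 1 ≤ σ.length →
    segSet (pts i) (pts (i + 1)) ∩ segSet (pts (i + 1)) (pts (i + 2)) = {pts (i + 1)}
  simple_nonadj : ∀ i j, i + 1 < j → j ≤ σ.length →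
    segSet (pts i) (pts (i + 1)) ∩ segSet (pts j) (pts (j + 1)) = ∅

/-- `A(σ)`: the set of points reachable by the turn sequence `σ`. -/
def ReachSet (σ : List Turn) : Set (ℤ × ℤ) :=
  {q | ∃ C : Chain σ, C.pts (σ.length + 1) = q}

/-- The halfplane `V⁺(p)` (requires `p.1 ≠ 0` to be meaningful). -/
def Vplus (p : ℤ × ℤ) : Set (ℤ × ℤ) :=
  {q | ∃ i j : ℤ, 0 ≤ i ∧ q = (p.1 + p.1.sign * i, j)}

/-- The halfplane `H⁺(p)` (requires `p.2 ≠ 0` to be meaningful). -/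
def Hplus (p : ℤ × ℤ) : Set (ℤ × ℤ) :=
  {q | ∃ i j : ℤ, 0 ≤ j ∧ q = (i, p.2 + p.2.sign * j)}

/-- The quadrant `Q⁺(p)`. -/
def Qplus (p : ℤ × ℤ) : Set (ℤ × ℤ) := Vplus p ∩ Hplus p

/-- A staircase: consecutive turns always differ. -/
def IsStaircase (σ : List Turn) : Prop := σ.Chain' (· ≠ ·)

/-- The prefix number `δᵢ`: number of `L`s minus number of `R`s among the first `i` turns. -/
def delta (σ : List Turn) (i : ℕ) : ℤ :=
  ((σ.take i).count Turn.L : ℤ) - ((σ.take i).count Turn.R : ℤ)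

/-- The excess number `l - r` of a turn sequence. -/
def excess (σ : List Turn) : ℤ := (σ.count Turn.L : ℤ) - (σ.count Turn.R : ℤ)

/-- `σ` has a hook (two equal consecutive turns, at 1-based positions `k+1, k+2`)
whose prefix number is `≡ d (mod 4)`: `d = 0, 1, 2, 3` for right, up, left, down hooks. -/
def HasHook (σ : List Turn) (d : ℤ) : Prop :=
  ∃ k, ∃ h : k + 1 < σ.length,
    σ.get ⟨k, by omega⟩ = σ.get ⟨k + 1, h⟩ ∧ delta σ (k + 1) % 4 = d

/-- `σ` has some hook, i.e. two equal consecutive turns. -/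
def HasAnyHook (σ : List Turn) : Prop :=
  ∃ k, ∃ h : k + 1 < σ.length, σ.get ⟨k, by omega⟩ = σ.get ⟨k + 1, h⟩

/-- A set `S ⊆ ℤ²` is connected: any two points of `S` are joined by a path inside `S`
whose consecutive points are at `L¹`-distance `1`. -/
def GridConnected (S : Set (ℤ × ℤ)) : Prop :=
  ∀ p ∈ S, ∀ q ∈ S, ∃ (n : ℕ) (f : ℕ → ℤ × ℤ),
    f 0 = p ∧ f n = q ∧ (∀ i ≤ n, f i ∈ S) ∧
    ∀ i < n, |(f (i + 1)).1 - (f i).1| + |(f (i + 1)).2 - (f i).2| = 1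

/-- `q` lies on the boundary of the smallest axis-parallel bounding box of the chain `C`
(for `q` a point of the chain: it attains an extreme coordinate). -/
def OnBBoxBoundary (σ : List Turn) (C : Chain σ) (q : ℤ × ℤ) : Prop :=
  (∀ i ≤ σ.length + 1, q.1 ≤ (C.pts i).1) ∨ (∀ i ≤ σ.length + 1, (C.pts i).1 ≤ q.1) ∨
  (∀ i ≤ σ.length + 1, q.2 ≤ (C.pts i).2) ∨ (∀ i ≤ σ.length + 1, (C.pts i).2 ≤ q.2)

/-- The last segment of the chain `C` is entirely contained in one side of the smallest
axis-parallel bounding box of `C`. -/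
def LastSegOnSide (σ : List Turn) (C : Chain σ) : Prop :=
  ((C.pts σ.length).1 = (C.pts (σ.length + 1)).1 ∧
     ∀ i ≤ σ.length + 1, (C.pts σ.length).1 ≤ (C.pts i).1) ∨
  ((C.pts σ.length).1 = (C.pts (σ.length + 1)).1 ∧
     ∀ i ≤ σ.length + 1, (C.pts i).1 ≤ (C.pts σ.length).1) ∨
  ((C.pts σ.length).2 = (C.pts (σ.length + 1)).2 ∧
     ∀ i ≤ σ.length + 1, (C.pts σ.length).2 ≤ (C.pts i).2) ∨
  ((C.pts σ.length).2 = (C.pts (σ.length + 1)).2 ∧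
     ∀ i ≤ σ.length + 1, (C.pts i).2 ≤ (C.pts σ.length).2)

/-- The turn `σₘ` (1-based indexing). -/
def turnAt (σ : List Turn) (m : ℕ) : Turn := σ.getD (m - 1) Turn.L

/-- The suffix `σ_k ⋯ σ_n` contains no hook and all its prefix numbers `δᵢ`,
`k - 1 ≤ i ≤ n`, are `≡ 1` or `2 (mod 4)` (the combinatorial description of a
NW-staircase containing the endpoint). -/
def GoodSuffix (σ : List Turn) (k : ℕ) : Prop :=
  1 ≤ k ∧ k ≤ σ.length ∧
  (∀ m : ℕ, k ≤ m → m < σ.length → turnAt σ m ≠ turnAt σ (m + 1)) ∧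
  (∀ i : ℕ, k - 1 ≤ i → i ≤ σ.length → delta σ i % 4 = 1 ∨ delta σ i % 4 = 2)

open Classical in
/-- `₋ₓm₊ᵧᵖ(σ)`: taking the longest good suffix (i.e. the least `k` with
`GoodSuffix σ k`), the number of indices `i` with `k - 1 ≤ i ≤ n` and
`δᵢ ≡ 1 (mod 4)`; `0` if no good suffix exists. -/
noncomputable def mNWp (σ : List Turn) : ℕ :=
  if ∃ k, GoodSuffix σ k then
    Nat.card {i : ℕ // sInf {k | GoodSuffix σ k} - 1 ≤ i ∧ i ≤ σ.length ∧
      delta σ i % 4 = 1}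
  else 0

/-- The number of vertical segments of the chain `C` meeting the closed horizontal
segment from the origin to `(a, 0)`. -/
def verticalCrossCount (σ : List Turn) (C : Chain σ) (a : ℤ) : ℕ :=
  ((Finset.range (σ.length + 1)).filter fun i =>
    (C.pts i).1 = (C.pts (i + 1)).1 ∧
    0 ≤ (C.pts i).1 ∧ (C.pts i).1 ≤ a ∧
    min (C.pts i).2 (C.pts (i + 1)).2 ≤ 0 ∧ 0 ≤ max (C.pts i).2 (C.pts (i + 1)).2).card

/-- The unit direction of the `(i+1)`-st segment of the chain `C`. -/
def dirOf (σ : List Turn) (C : Chain σ) (i : ℕ) : ℤ × ℤ := unitDir (C.pts i) (C.pts (i + 1))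

/-- `z₁mz₂ᵒ(C)`: the number of `z₂`-segments in the maximal `(z₁,z₂)`-staircase subchain
of `C` containing the origin (the longest prefix of segments directed `z₁` or `z₂`);
`0` if no such subchain exists. -/
noncomputable def stairCountO (σ : List Turn) (C : Chain σ) (z₁ z₂ : ℤ × ℤ) : ℕ :=
  Nat.card {i : ℕ // i ≤ σ.length ∧ dirOf σ C i = z₂ ∧
    ∀ j ≤ i, dirOf σ C j = z₁ ∨ dirOf σ C j = z₂}

/-- `z₁mz₂ᵖ(C)`: the number of `z₂`-segments in the maximal `(z₁,z₂)`-staircase subchain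
of `C` containing the endpoint (the longest suffix of segments directed `z₁` or `z₂`);
`0` if no such subchain exists. -/
noncomputable def stairCountP (σ : List Turn) (C : Chain σ) (z₁ z₂ : ℤ × ℤ) : ℕ :=
  Nat.card {i : ℕ // i ≤ σ.length ∧ dirOf σ C i = z₂ ∧
    ∀ j, i ≤ j → j ≤ σ.length → dirOf σ C j = z₁ ∨ dirOf σ C j = z₂}

/-! ### The lifted secant angle of a rectilinear path -/

namespace RectPath

/-- The segment from `u` to `v` points in the direction obtained from east by `d`
counterclockwise quarter turns. -/
def HasDir (d : ℤ) (u v : ℤ × ℤ) : Prop :=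
  (d % 4 = 0 ∧ v.2 = u.2 ∧ u.1 < v.1) ∨ (d % 4 = 1 ∧ v.1 = u.1 ∧ u.2 < v.2) ∨
  (d % 4 = 2 ∧ v.2 = u.2 ∧ v.1 < u.1) ∨ (d % 4 = 3 ∧ v.1 = u.1 ∧ v.2 < u.2)

/-- Indicator of the closed upper half-plane, in terms of the ordinate. -/
def upper (y : ℤ) : ℤ := if 0 ≤ y then 1 else 0

/-- Signed number of crossings of the ray issuing eastwards from just below the origin
by an axis-parallel segment with initial abscissa `x` and ordinates `y`, `z`. -/
def rayCross (x y z : ℤ) : ℤ := if 0 < x then upper z - upper y else 0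

lemma HasDir.axis_parallel {d : ℤ} {u v : ℤ × ℤ} (h : HasDir d u v) :
    v.2 = u.2 ∨ v.1 = u.1 := by
  simp only [HasDir] at h
  omega

lemma rayCross_self (x y : ℤ) : rayCross x y y = 0 := by
  simp [rayCross]

/-- Ray crossing of the secant `p j - p i` when `j` advances. -/
def headCross (p : ℕ → ℤ × ℤ) (i j : ℕ) : ℤ :=
  rayCross ((p j).1 - (p i).1) ((p j).2 - (p i).2) ((p (j + 1)).2 - (p i).2)

/-- Ray crossing of the secant `p j - p i` when `i` advances. -/
def tailCross (p : ℕ → ℤ × ℤ) (i j : ℕ) : ℤ :=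
  rayCross ((p j).1 - (p i).1) ((p j).2 - (p i).2) ((p j).2 - (p (i + 1)).2)

/-- The number of full turns, rounded down, of the lifted angle of the secant `p j - p i`. -/
def secantTurns (p : ℕ → ℤ × ℤ) (d : ℕ → ℤ) (i j : ℕ) : ℤ :=
  d i / 4 + ∑ k ∈ Finset.Ico (i + 1) j, headCross p i k

/-- A simple rectilinear path with segments `0, …, n` whose `i`-th direction is `d i`. -/
structure IsSimple (p : ℕ → ℤ × ℤ) (d : ℕ → ℤ) (n : ℕ) : Prop where
  dir : ∀ i ≤ n, HasDir (d i) (p i) (p (i + 1))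
  turn : ∀ i < n, d (i + 1) = d i + 1 ∨ d (i + 1) = d i - 1
  disjoint : ∀ i j, i + 1 < j → j ≤ n → ∀ q, q ∈ segSet (p i) (p (i + 1)) →
    q ∉ segSet (p j) (p (j + 1))

variable {p : ℕ → ℤ × ℤ} {d : ℕ → ℤ} {n : ℕ}

lemma secantTurns_self_succ (i : ℕ) : secantTurns p d i (i + 1) = d i / 4 := by
  simp [secantTurns]

lemma secantTurns_succ_right {i j : ℕ} (h : i < j) :
    secantTurns p d i (j + 1) = secantTurns p d i j + headCross p i j := by
  rw [secantTurns, secantTurns, Finset.sum_Ico_succ_top (by omega)]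
  ring

lemma IsSimple.corner (hp : IsSimple p d n) {i : ℕ} (hi : i < n) :
    headCross p i (i + 1) + tailCross p i (i + 2) = d (i + 1) / 4 - d i / 4 := by
  have h1 := hp.dir i hi.le
  have h2 := hp.dir (i + 1) hi
  have h3 := hp.turn i hi
  simp only [HasDir, headCross, tailCross, rayCross, upper, show i + 1 + 1 = i + 2 from rfl]
    at h1 h2 ⊢
  rcases h3 with h3 | h3 <;> rcases h1 with h1 | h1 | h1 | h1 <;>
    rcases h2 with h2 | h2 | h2 | h2 <;> omega

lemma IsSimple.square (hp : IsSimple p d n) {i j : ℕ} (hij : i + 1 < j) (hj : j ≤ n) :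
    headCross p i j + tailCross p i (j + 1) = tailCross p i j + headCross p (i + 1) j := by
  have h1 := (hp.dir i (by omega)).axis_parallel
  have h2 := (hp.dir j hj).axis_parallel
  have h3 := hp.disjoint i j hij hj
  have hA := h3 ((p i).1, (p j).2)
  have hB := h3 ((p j).1, (p i).2)
  simp only [headCross, tailCross, segSet, Set.mem_ofPred_eq] at hA hB ⊢
  rcases h1 with h1 | h1 <;> rcases h2 with h2 | h2 <;>
    simp only [h1, h2, rayCross_self, min_self, max_self, zero_add, add_zero] at hA hB ⊢
  · simp only [rayCross, upper]
    split_ifs <;> omega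
  · simp only [rayCross, upper]
    split_ifs <;> omega
  · simp only [rayCross]
    split_ifs <;> ring

lemma IsSimple.secantTurns_succ_left (hp : IsSimple p d n) {i j : ℕ} (hij : i + 2 ≤ j)
    (hj : j ≤ n + 1) :
    secantTurns p d (i + 1) j = secantTurns p d i j + tailCross p i j := by
  induction j, hij using Nat.le_induction with
  | base =>
    have := hp.corner (i := i) (by omega)
    rw [secantTurns_self_succ, secantTurns_succ_right (Nat.lt_succ_self i),
      secantTurns_self_succ]
    linarith
  | succ j hij ih =>
    have := hp.square (i := i) (j := j) (by omega) (by omega)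
    rw [secantTurns_succ_right (by omega), secantTurns_succ_right (by omega), ih (by omega)]
    linarith

lemma secantTurns_eq_add_sum_headCross {i j k : ℕ} (hij : i < j) (hjk : j ≤ k) :
    secantTurns p d i k = secantTurns p d i j + ∑ l ∈ Finset.Ico j k, headCross p i l := by
  induction k, hjk using Nat.le_induction with
  | base => simp
  | succ k hjk ih =>
    rw [secantTurns_succ_right (by omega), ih, Finset.sum_Ico_succ_top hjk]
    ring

lemma IsSimple.secantTurns_eq_add_sum_tailCross (hp : IsSimple p d n) {i j k : ℕ}
    (hij : i ≤ j) (hjk : j < k) (hk : k ≤ n + 1) :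
    secantTurns p d j k = secantTurns p d i k + ∑ l ∈ Finset.Ico i j, tailCross p l k := by
  induction j, hij using Nat.le_induction with
  | base => simp
  | succ j hij ih =>
    rw [hp.secantTurns_succ_left (by omega) hk, ih (by omega), Finset.sum_Ico_succ_top hij]
    ring

/-- Signed crossing of the `i`-th segment with the part of the line `y = -1/2` strictly
between the abscissas `0` and `a`. -/
def gapCross (p : ℕ → ℤ × ℤ) (a : ℤ) (i : ℕ) : ℤ :=
  if 0 < (p i).1 ∧ (p i).1 < a then upper (p (i + 1)).2 - upper (p i).2 else 0

/-- Boundary term relating ray crossings to gap crossings. -/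
def sideIndicator (a : ℤ) (q : ℤ × ℤ) : ℤ :=
  (if a ≤ q.1 ∧ q.2 = 0 then 1 else 0) + if 0 < q.2 then 1 else 0

/-- A simple path from the origin to `(a, 0)` with first segment directed east and last
segment directed west. -/
structure IsHooked (p : ℕ → ℤ × ℤ) (d : ℕ → ℤ) (n : ℕ) (a : ℤ) : Prop extends
    IsSimple p d n where
  pos : 0 < a
  two_le : 2 ≤ n
  start : p 0 = (0, 0)
  finish : p (n + 1) = (a, 0)
  first : d 0 = 0
  last : d n % 4 = 2

variable {a : ℤ}

lemma IsHooked.headCross_sub_tailCross (hp : IsHooked p d n a) {i : ℕ} (hi : i ≤ n) :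
    headCross p 0 i - tailCross p i (n + 1) =
      gapCross p a i + (sideIndicator a (p (i + 1)) - sideIndicator a (p i)) := by
  have h1 := hp.dir i hi
  have h2 := hp.dir n le_rfl
  have hl := hp.last
  have ha := hp.pos
  have hf := hp.finish
  have hA : i ≠ n → ((p i).2 = 0 → (p (i + 1)).2 = 0 → (a ≤ (p i).1 ↔ a ≤ (p (i + 1)).1)) := by
    intro hne y0 y1
    rcases Nat.lt_or_ge (i + 1) n with hin | hin
    · have := hp.disjoint i n hin le_rfl (a, 0)
      simp only [HasDir, segSet, Set.mem_ofPred_eq, hf] at h1 h2 this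
      omega
    · obtain rfl : n = i + 1 := by omega
      have := hp.turn i (by omega)
      simp only [HasDir] at h1
      omega
  simp only [headCross, tailCross, hp.start, hf, gapCross, sideIndicator, sub_zero, zero_sub]
  rcases h1.axis_parallel with h | h
  · simp only [h, rayCross_self, sub_self, ite_self]
    by_cases hin : i = n
    · subst hin
      simp only [HasDir, hf] at h1 ⊢
      split_ifs <;> omega
    · have hA := hA hin
      split_ifs <;> omega
  · simp only [h]
    generalize (p i).1 = x
    generalize (p i).2 = y
    generalize (p (i + 1)).2 = z
    simp only [rayCross, upper, sub_pos]
    rcases lt_or_ge 0 x with h0 | h0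
    · rcases lt_or_ge x a with h1 | h1
      · simp only [h0, h1, h1.not_ge, and_self, false_and, if_true, if_false]
        split_ifs <;> omega
      · simp only [h0, h1, h1.not_gt, true_and, and_false, if_true, if_false]
        split_ifs <;> omega
    · have h1 : x < a := by omega
      simp only [h0.not_gt, h1, h1.not_ge, false_and, if_true, if_false]
      split_ifs <;> omega

lemma IsHooked.sum_headCross_sub_tailCross (hp : IsHooked p d n a) {i j : ℕ} (hij : i ≤ j)
    (hj : j ≤ n + 1) :
    ∑ l ∈ Finset.Ico i j, headCross p 0 l - ∑ l ∈ Finset.Ico i j, tailCross p l (n + 1) =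
      ∑ l ∈ Finset.Ico i j, gapCross p a l +
        (sideIndicator a (p j) - sideIndicator a (p i)) := by
  rw [← Finset.sum_sub_distrib, ← Finset.sum_Ico_sub (fun l => sideIndicator a (p l)) hij,
    ← Finset.sum_add_distrib]
  refine Finset.sum_congr rfl fun l hl => hp.headCross_sub_tailCross ?_
  rw [Finset.mem_Ico] at hl
  omega

lemma headCross_self_self : headCross p 0 0 = 0 := by
  simp [headCross, rayCross]

lemma IsHooked.tailCross_last (hp : IsHooked p d n a) : tailCross p n (n + 1) = 0 := by
  have h := hp.dir n le_rfl
  have hl := hp.last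
  simp only [HasDir, tailCross, rayCross, upper] at h ⊢
  split_ifs <;> omega

lemma IsHooked.secantTurns_zero (hp : IsHooked p d n a) {j : ℕ} (hj : 0 < j) :
    secantTurns p d 0 j = ∑ l ∈ Finset.Ico 0 j, headCross p 0 l := by
  rw [Finset.sum_eq_sum_Ico_succ_bot hj, headCross_self_self, secantTurns, hp.first]
  simp

lemma IsHooked.last_div_four (hp : IsHooked p d n a) {i : ℕ} (hi : i ≤ n) :
    d n / 4 = secantTurns p d i (n + 1) +
      ∑ l ∈ Finset.Ico i (n + 1), tailCross p l (n + 1) := by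
  rw [Finset.sum_Ico_succ_top hi, hp.tailCross_last, ← secantTurns_self_succ (p := p),
    hp.secantTurns_eq_add_sum_tailCross hi (by omega) le_rfl, add_zero]

lemma IsHooked.sideIndicator_start (hp : IsHooked p d n a) :
    sideIndicator a (p 0) = 0 := by
  simp [sideIndicator, hp.start, hp.pos]

lemma IsHooked.sideIndicator_finish (hp : IsHooked p d n a) :
    sideIndicator a (p (n + 1)) = 1 := by
  simp [sideIndicator, hp.finish]

/-- A hooked path in the upper half-plane has total turning `-2`. -/
lemma IsHooked.last_div_four_of_nonneg (hp : IsHooked p d n a)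
    (hy : ∀ i ≤ n + 1, 0 ≤ (p i).2) : d n / 4 = -1 := by
  have h1 := hp.last_div_four (Nat.zero_le n)
  rw [hp.secantTurns_zero (by omega)] at h1
  have h2 := hp.sum_headCross_sub_tailCross (Nat.zero_le (n + 1)) le_rfl
  have h3 : ∑ l ∈ Finset.Ico 0 (n + 1), headCross p 0 l = 0 := by
    refine Finset.sum_eq_zero fun l hl => ?_
    rw [Finset.mem_Ico] at hl
    simp [headCross, rayCross, upper, hp.start, hy l (by omega), hy (l + 1) (by omega)]
  have h4 : ∑ l ∈ Finset.Ico 0 (n + 1), gapCross p a l = 0 := by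
    refine Finset.sum_eq_zero fun l hl => ?_
    rw [Finset.mem_Ico] at hl
    simp [gapCross, upper, hy l (by omega), hy (l + 1) (by omega)]
  rw [hp.sideIndicator_start, hp.sideIndicator_finish] at h2
  linarith

/-- The secant towards a lowest point turns by at most a half turn. -/
lemma IsHooked.secantTurns_lowest (hp : IsHooked p d n a) {M : ℕ} (hM : M ≤ n)
    (hneg : (p (M + 1)).2 < 0) (hmin : ∀ i ≤ n + 1, (p (M + 1)).2 ≤ (p i).2) :
    d M / 4 = secantTurns p d 0 (M + 1) + if d M % 4 = 0 then 1 else 0 := by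
  set h : ℕ → ℤ := fun i => if (p i).2 = (p (M + 1)).2 ∧ (p i).1 < (p (M + 1)).1 then 1 else 0
    with hdef
  have key : ∀ l ∈ Finset.Ico 0 M, tailCross p l (M + 1) = h (l + 1) - h l := by
    intro l hl
    rw [Finset.mem_Ico] at hl
    have h1 := hp.dir l (by omega)
    have hm1 := hmin l (by omega)
    have hm2 := hmin (l + 1) (by omega)
    have h2 := hp.dir M hM
    have hA : (p l).2 = (p (M + 1)).2 → (p (l + 1)).2 = (p (M + 1)).2 →
        ((p l).1 < (p (M + 1)).1 ↔ (p (l + 1)).1 < (p (M + 1)).1) := by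
      intro y0 y1
      rcases Nat.lt_or_ge (l + 1) M with hlM | hlM
      · have := hp.disjoint l M hlM hM (p (M + 1))
        simp only [HasDir, segSet, Set.mem_ofPred_eq] at h1 h2 this
        omega
      · obtain rfl : M = l + 1 := by omega
        have := hp.turn l (by omega)
        simp only [HasDir] at h1 h2
        omega
    simp only [HasDir, tailCross, rayCross, upper, hdef] at h1 ⊢
    rcases h1 with h1 | h1 | h1 | h1 <;> split_ifs <;> omega
  have h1 := hp.secantTurns_eq_add_sum_tailCross (Nat.zero_le M) (Nat.lt_succ_self M)
    (by omega)
  rw [secantTurns_self_succ, Finset.sum_congr rfl key,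
    Finset.sum_Ico_sub h (Nat.zero_le M)] at h1
  have h2 := hp.dir M hM
  have h0 : h 0 = 0 := by simp [hdef, hp.start, hneg.ne']
  have hh : h M = if d M % 4 = 0 then 1 else 0 := by
    simp only [HasDir, hdef] at h2 ⊢
    split_ifs <;> omega
  rw [h1, h0, hh]
  ring

/-- Turning of a hooked path in terms of its gap crossings before and after a lowest point. -/
lemma IsHooked.exists_last_eq (hp : IsHooked p d n a) {M : ℕ} (hM : M + 1 ≤ n)
    (hneg : (p (M + 1)).2 < 0) (hmin : ∀ i ≤ n + 1, (p (M + 1)).2 ≤ (p i).2) :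
    ∃ e : ℤ, (e = 0 ∨ e = 1) ∧
      d n / 4 + 1 = ∑ l ∈ Finset.Ico 0 (M + 1), gapCross p a l -
        ∑ l ∈ Finset.Ico (M + 1) (n + 1), gapCross p a l + 2 * e := by
  refine ⟨d (M + 1) / 4 - d M / 4 + if d M % 4 = 0 then 1 else 0, ?_, ?_⟩
  · have h1 := hp.dir M (by omega)
    have h2 := hp.dir (M + 1) hM
    have h3 := hp.turn M hM
    have h4 := hmin M (by omega)
    have h5 := hmin (M + 2) (by omega)
    simp only [HasDir, show M + 1 + 1 = M + 2 from rfl] at h1 h2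
    split_ifs <;> omega
  · have h1 := hp.secantTurns_lowest (by omega) hneg hmin
    have h2 := hp.secantTurns_zero (Nat.succ_pos M)
    have h3 := hp.last_div_four hM
    have h4 : secantTurns p d (M + 1) (n + 1) = d (M + 1) / 4 := by
      rw [secantTurns, Finset.sum_eq_zero, add_zero]
      intro l hl
      rw [Finset.mem_Ico] at hl
      simp [headCross, rayCross, upper, hmin l (by omega), hmin (l + 1) (by omega)]
    have h5 := hp.secantTurns_eq_add_sum_tailCross (Nat.zero_le (M + 1))
      (show M + 1 < n + 1 by omega) le_rfl
    have h6 := secantTurns_eq_add_sum_headCross (p := p) (d := d) (Nat.succ_pos M)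
      (show M + 1 ≤ n + 1 by omega)
    have h7 := hp.sum_headCross_sub_tailCross (Nat.zero_le (M + 1)) (by omega)
    have h8 := hp.sum_headCross_sub_tailCross (show M + 1 ≤ n + 1 by omega) le_rfl
    have s0 := hp.sideIndicator_start
    have s1 : sideIndicator a (p (M + 1)) = 0 := by
      simp [sideIndicator, hneg.ne, hneg.le]
    have s2 := hp.sideIndicator_finish
    simp only [Nat.succ_eq_add_one] at h2 h6
    linarith

lemma IsHooked.first_lt (hp : IsHooked p d n a) : 0 < (p 1).1 ∧ (p 1).1 < a ∧ (p 1).2 = 0 := by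
  have h1 := hp.dir 0 (Nat.zero_le n)
  have h2 := hp.disjoint 0 n (by have := hp.two_le; omega) le_rfl (a, 0)
  have ha := hp.pos
  simp only [HasDir, hp.first, hp.start, hp.finish, segSet, Set.mem_ofPred_eq, zero_add]
    at h1 h2
  omega

/-- After its first turn, a hooked path crosses each column of the gap at most once, and
it never crosses the column of the first turn. -/
lemma IsHooked.sum_abs_gapCross_le (hp : IsHooked p d n a) :
    ∑ i ∈ Finset.Ico 2 (n + 1), |gapCross p a i| ≤ a - 2 := by
  obtain ⟨ht0, hta, hty⟩ := hp.first_lt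
  set S := (Finset.Ico 2 (n + 1)).filter fun i => gapCross p a i ≠ 0 with hS
  have mem : ∀ i ∈ S, 2 ≤ i ∧ i ≤ n ∧ 0 < (p i).1 ∧ (p i).1 < a ∧ (p (i + 1)).1 = (p i).1 ∧
      d i % 2 = 1 ∧ ((p i).1, 0) ∈ segSet (p i) (p (i + 1)) := by
    intro i hi
    rw [hS, Finset.mem_filter, Finset.mem_Ico] at hi
    obtain ⟨⟨h2, hn⟩, hne⟩ := hi
    have h1 := hp.dir i (by omega)
    simp only [HasDir, gapCross, upper, segSet, Set.mem_ofPred_eq] at h1 hne ⊢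
    split_ifs at hne <;> omega
  have hle : ∑ i ∈ Finset.Ico 2 (n + 1), |gapCross p a i| ≤ (S.card : ℤ) := by
    rw [hS, Finset.card_filter, Nat.cast_sum]
    refine Finset.sum_le_sum fun i _ => ?_
    by_cases h : gapCross p a i = 0
    · simp [h]
    · simp only [ne_eq, h, not_false_eq_true, if_true, Nat.cast_one, abs_le]
      simp only [gapCross, upper]
      split_ifs <;> omega
  have hcard : S.card ≤ ((Finset.Ioo 0 a).erase (p 1).1).card := by
    refine Finset.card_le_card_of_injOn (fun i => (p i).1) ?_ ?_
    · intro i hi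
      obtain ⟨h2, hn, hx0, hxa, -, -, hseg⟩ := mem i hi
      simp only [Finset.coe_erase, Finset.coe_Ioo, Set.mem_sdiff, Set.mem_Ioo,
        Set.mem_singleton_iff]
      refine ⟨⟨hx0, hxa⟩, fun heq => hp.disjoint 0 i (by omega) hn (p 1) ?_ ?_⟩
      · simp [segSet]
      · rwa [heq, ← hty] at hseg
    · have aux : ∀ i ∈ S, ∀ j ∈ S, i < j → (p i).1 ≠ (p j).1 := by
        intro i hi j hj hij heq
        obtain ⟨-, hin, -, -, -, hdi, hsi⟩ := mem i hi
        obtain ⟨-, hjn, -, -, -, hdj, hsj⟩ := mem j hj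
        rcases Nat.lt_or_ge (i + 1) j with h | h
        · exact hp.disjoint i j h hjn _ hsi (heq ▸ hsj)
        · obtain rfl : j = i + 1 := by omega
          have := hp.turn i (by omega)
          omega
      intro i hi j hj heq
      rcases lt_trichotomy i j with h | h | h
      · exact absurd heq (aux i hi j hj h)
      · exact h
      · exact absurd heq.symm (aux j hj i hi h)
  rw [Finset.card_erase_of_mem (by simp [ht0, hta]), Int.card_Ioo] at hcard
  omega

/-- The total turning of a hooked path is controlled by the length of its gap. -/
lemma IsHooked.last_bounds (hp : IsHooked p d n a) (hd : 0 ≤ d n) :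
    (d 1 = 1 → |d n / 4 + 1 - 2| + 2 ≤ a) ∧ (d 1 = -1 → d n / 4 + 1 + 1 ≤ a) := by
  obtain ⟨K, hK, hmin⟩ := Finset.exists_min_image (Finset.range (n + 2)) (fun i => (p i).2)
    ⟨0, by simp⟩
  simp only [Finset.mem_range] at hK hmin
  have hneg : (p K).2 < 0 := by
    by_contra hcon
    have := hp.last_div_four_of_nonneg fun i hi => (not_lt.1 hcon).trans (hmin i (by omega))
    omega
  obtain ⟨ht0, hta, hty⟩ := hp.first_lt
  have hK0 : K ≠ 0 := by rintro rfl; simp [hp.start] at hneg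
  have hK1 : K ≠ 1 := by rintro rfl; omega
  have hKn : K ≠ n + 1 := by rintro rfl; simp [hp.finish] at hneg
  obtain ⟨M, rfl⟩ : ∃ M, K = M + 1 := ⟨K - 1, by omega⟩
  obtain ⟨e, he, hsum⟩ := hp.exists_last_eq (M := M) (by omega) hneg
    fun i hi => hmin i (by omega)
  have habs := hp.sum_abs_gapCross_le
  rw [← Finset.sum_Ico_consecutive _ (show 2 ≤ M + 1 by omega) (show M + 1 ≤ n + 1 by omega)]
    at habs
  have b1 := abs_le.1 (Finset.abs_sum_le_sum_abs (gapCross p a) (Finset.Ico 2 (M + 1)))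
  have b2 := abs_le.1
    (Finset.abs_sum_le_sum_abs (gapCross p a) (Finset.Ico (M + 1) (n + 1)))
  rw [Finset.sum_eq_sum_Ico_succ_bot (show 0 < M + 1 by omega),
    Finset.sum_eq_sum_Ico_succ_bot (show 0 + 1 < M + 1 by omega)] at hsum
  have g0 : gapCross p a 0 = 0 := by simp [gapCross, hp.start]
  have h1 := hp.dir 1 (by have := hp.two_le; omega)
  simp only [zero_add, Nat.reduceAdd, g0] at hsum
  constructor
  · intro hd1
    have g1 : gapCross p a 1 = 0 := by
      simp only [HasDir, gapCross, upper, hd1, Nat.reduceAdd] at h1 ⊢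
      split_ifs <;> omega
    rw [g1] at hsum
    rcases abs_cases (d n / 4 + 1 - 2) with h | h <;> omega
  · intro hd1
    have g1 : gapCross p a 1 = -1 := by
      simp only [HasDir, gapCross, upper, hd1, Nat.reduceAdd] at h1 ⊢
      split_ifs <;> omega
    rw [g1] at hsum
    omega

end RectPath

open RectPath

lemma delta_succ {σ : List Turn} {i : ℕ} (h : i < σ.length) :
    delta σ (i + 1) = delta σ i + if σ.get ⟨i, h⟩ = Turn.L then 1 else -1 := by
  rw [delta, delta, List.take_add_one, List.getElem?_eq_getElem h]
  simp only [Option.toList_some, List.count_append, List.get_eq_getElem]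
  obtain h | h : σ[i] = Turn.L ∨ σ[i] = Turn.R := by
    rcases σ[i] with _ | _ <;> simp
  · simp [h]
    ring
  · simp [h]
    ring

lemma delta_length (σ : List Turn) : delta σ σ.length = excess σ := by
  simp [delta, excess]

lemma Chain.hasDir {σ : List Turn} (C : Chain σ) {i : ℕ} (hi : i ≤ σ.length) :
    HasDir (delta σ i) (C.pts i) (C.pts (i + 1)) := by
  induction i with
  | zero =>
    obtain ⟨t, ht, h1⟩ := C.first_seg
    simp [HasDir, delta, C.start_eq, h1, ht]
  | succ i ih =>
    have h1 := ih (by omega)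
    have h2 := C.turns i hi
    have h3 := delta_succ hi
    simp only [HasDir, show i + 1 + 1 = i + 2 from rfl]
    rcases h1 with ⟨hd, hu, hv⟩ | ⟨hd, hu, hv⟩ | ⟨hd, hu, hv⟩ | ⟨hd, hu, hv⟩ <;>
      split_ifs at h2 h3 <;>
      simp only [unitDir, rotCCW, rotCW, hu, sub_self, Int.sign_zero, neg_zero,
        Int.sign_eq_one_of_pos (sub_pos.2 hv), Int.sign_eq_neg_one_of_neg (sub_neg.2 hv),
        Prod.mk.injEq, neg_neg, Int.sign_eq_zero_iff_zero, Int.sign_eq_one_iff_pos,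
        Int.sign_eq_neg_one_iff_neg] at h2 <;>
      omega

lemma Chain.isSimple {σ : List Turn} (C : Chain σ) :
    IsSimple C.pts (delta σ) σ.length where
  dir i hi := C.hasDir hi
  turn i hi := by
    rw [delta_succ hi]
    split_ifs
    · exact Or.inl rfl
    · exact Or.inr rfl
  disjoint i j hij hj q hqi hqj := by
    have : q ∈ (∅ : Set (ℤ × ℤ)) := C.simple_nonadj i j hij hj ▸ ⟨hqi, hqj⟩
    exact this

/-- **Lower bound on the closest reachable point on the `+x`-axis when
`l - r ≡ 2 (mod 4)`.** -/
theorem lower_bound_x_plus_mod_two (σ : List Turn) (h0 : 0 ≤ excess σ)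
    (h2 : excess σ % 4 = 2) (C : Chain σ) (a : ℤ) (ha : 0 < a)
    (hend : C.pts (σ.length + 1) = (a, 0)) :
    (σ.head? = some Turn.L → |(excess σ + 2) / 4 - 2| + 2 ≤ a) ∧
    (σ.head? = some Turn.R → (excess σ + 2) / 4 + 1 ≤ a) := by
  have hlen : 2 ≤ σ.length := by
    have h1 := List.count_le_length (a := Turn.L) (l := σ)
    rw [excess] at h0 h2
    omega
  have hp : IsHooked C.pts (delta σ) σ.length a :=
    { C.isSimple with
      pos := ha
      two_le := hlen
      start := C.start_eq
      finish := hend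
      first := by simp [delta]
      last := by rwa [delta_length] }
  have hb := hp.last_bounds (by rwa [delta_length])
  rw [delta_length] at hb
  have hm : (excess σ + 2) / 4 = excess σ / 4 + 1 := by omega
  rw [hm]
  have hd : delta σ 1 = _ := delta_succ (σ := σ) (i := 0) (by omega)
  refine ⟨fun h => hb.1 ?_, fun h => hb.2 ?_⟩ <;>
  · cases σ with
    | nil => simp at h
    | cons s τ =>
      simp only [List.head?_cons, Option.some.injEq] at h
      subst h
      simp [delta]
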